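/- Let A be a Köthe matrix satisfying condition (G1-1). Then for every integer s ≥ 1, the map x ↦ C x − (1/s)·x from λ₀(A) to λ₀(A) is not surjective; that is, there exists z ∈ λ₀(A) such that no x ∈ λ₀(A) satisfies C x − (1/s)·x = z. (Consequently every point of Σ = {1/k : k ∈ ℕ} belongs to the spectrum of C on λ₀(A).) -/

import Mathlib

open Filter Finset Topology

noncomputable section

/-- A Köthe matrix: entries are nonnegative, increasing in `n`, and for each column some
entry is positive.  (Index `i : ℕ` corresponds to the index `i + 1` of the paper.) -/
def KotheMatrix (a : ℕ → ℕ → ℝ) : Prop :=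
  (∀ n i, 0 ≤ a n i ∧ a n i ≤ a (n + 1) i) ∧ ∀ i, ∃ n, 0 < a n i

/-- Condition (G1-1): `0 < a_n(i+1) ≤ a_n(i)`. -/
def G11 (a : ℕ → ℕ → ℝ) : Prop :=
  ∀ n i, 0 < a n (i + 1) ∧ a n (i + 1) ≤ a n i

/-- Condition (G1-2). -/
def G12 (a : ℕ → ℕ → ℝ) : Prop :=
  ∀ n, ∃ m > n, ∃ C > 0, ∀ i, a n i ≤ C * a m i ^ 2

/-- Membership in the Köthe echelon space of order zero `λ₀(A)`. -/
def inLambda0 (a : ℕ → ℕ → ℝ) (x : ℕ → ℂ) : Prop :=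
  ∀ n, Tendsto (fun i => a n i * ‖x i‖) atTop (𝓝 0)

/-- The canonical seminorms `p_n(x) = sup_i a_n(i) |x_i|` of `λ₀(A)`. -/
def pnorm (a : ℕ → ℕ → ℝ) (n : ℕ) (x : ℕ → ℂ) : ℝ :=
  ⨆ i, a n i * ‖x i‖

/-- The discrete Cesàro operator, `(C x)_i = (x_1 + ⋯ + x_i) / i` (indices shifted by one). -/
def cesaro (x : ℕ → ℂ) : ℕ → ℂ :=
  fun i => (∑ j ∈ Finset.range (i + 1), x j) / ((i : ℂ) + 1)

/-- Finitely supported unit vectors belong to `λ₀(A)`. -/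
theorem inLambda0_single (a : ℕ → ℕ → ℝ) (t : ℕ) (c : ℂ) : inLambda0 a (Pi.single t c) := by
  intro n
  refine tendsto_const_nhds.congr' ?_
  filter_upwards [eventually_gt_atTop t] with i hi
  simp [Pi.single_eq_of_ne hi.ne']

/-- If `x` vanishes before `i`, then `(C x)_i` is its diagonal part. -/
theorem cesaro_of_forall_lt {x : ℕ → ℂ} {i : ℕ} (h : ∀ j < i, x j = 0) :
    cesaro x i = x i / ((i : ℂ) + 1) := by
  rw [cesaro, Finset.sum_range_succ,
    Finset.sum_eq_zero fun j hj => h j (Finset.mem_range.1 hj), zero_add]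

/-- If `C x - x / (t + 1)` vanishes before `t`, then so does `x`. -/
theorem eq_zero_of_cesaro_sub_eq_zero {x : ℕ → ℂ} {t : ℕ}
    (h : ∀ i < t, cesaro x i - (1 / ((t : ℂ) + 1)) * x i = 0) : ∀ i < t, x i = 0 := by
  intro i
  induction i using Nat.strong_induction_on with
  | _ i ih =>
    intro hi
    have hx := h i hi
    rw [cesaro_of_forall_lt fun j hj => ih j hj (hj.trans hi)] at hx
    have hi0 : (i : ℂ) + 1 ≠ 0 := Nat.cast_add_one_ne_zero i
    have ht0 : (t : ℂ) + 1 ≠ 0 := Nat.cast_add_one_ne_zero t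
    have hne : (t : ℂ) - i ≠ 0 := sub_ne_zero.2 (Nat.cast_injective.ne hi.ne')
    field_simp at hx
    refine (mul_eq_zero.1 (?_ : ((t : ℂ) - i) * x i = 0)).resolve_left hne
    linear_combination hx

/-- For a Köthe matrix satisfying (G1-1), and every integer `s ≥ 1`, the map
`x ↦ C x − (1/s)·x` is not surjective from `λ₀(A)` onto `λ₀(A)`. -/
theorem stmt10 (a : ℕ → ℕ → ℝ) (hK : KotheMatrix a) (hG : G11 a) :
    ∀ s : ℕ, 1 ≤ s →
      ∃ z : ℕ → ℂ, inLambda0 a z ∧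
        ¬ ∃ x : ℕ → ℂ, inLambda0 a x ∧ ∀ i, cesaro x i - (1 / (s : ℂ)) * x i = z i := by
  intro s hs
  obtain ⟨t, rfl⟩ : ∃ t, s = t + 1 := ⟨s - 1, by omega⟩
  refine ⟨Pi.single t 1, inLambda0_single a t 1, ?_⟩
  rintro ⟨x, -, hx⟩
  push_cast at hx
  have h0 : ∀ i < t, x i = 0 := eq_zero_of_cesaro_sub_eq_zero fun i hi => by
    rw [hx i, Pi.single_eq_of_ne hi.ne]
  have h1 := hx t
  rw [cesaro_of_forall_lt h0, Pi.single_eq_same, div_eq_mul_one_div, mul_comm, sub_self] at h1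
  exact zero_ne_one h1
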